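/- Let D = {(X,Y) ∈ ℝ^d × ℝ^d : X ≠ wY for all w ∈ W} and, on D, let R(X,Y) = ∑_{w∈W} det(w) |X − wY|^{−d}. Then: (1) R(X,Y) = R(Y,X) for all (X,Y) ∈ D; (2) R(w₀X, Y) = det(w₀)·R(X,Y) and R(X, w₀Y) = det(w₀)·R(X,Y) for all w₀ ∈ W and (X,Y) ∈ D; (3) R(X,Y) = 0 whenever (X,Y) ∈ D and at least one of X, Y is singular; (4) there exists a real-analytic function f : D → ℝ such that R(X,Y) = π(X)·π(Y)·f(X,Y) for all (X,Y) ∈ D (equivalently, the function T(X,Y) = R(X,Y)/(π(X)π(Y)), defined where π(X)π(Y) ≠ 0, extends to a real-analytic function on D). -/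

import Mathlib

open scoped BigOperators RealInnerProductSpace Classical
open Finset

noncomputable section

/-- Euclidean space `ℝ^d`. -/
abbrev E (d : ℕ) := EuclideanSpace ℝ (Fin d)

/-- The reflection `s_α x = x - 2 (⟪α, x⟫/⟪α, α⟫) α` fixing the hyperplane `α^⊥`. -/
def reflVec {d : ℕ} (α x : E d) : E d := x - (2 * ⟪α, x⟫ / ⟪α, α⟫) • α

/-- `Sig` is a reduced root system in `ℝ^d`: a finite set of nonzero vectors spanning `ℝ^d`,
with `Sig ∩ ℝα = {α, -α}` and `s_α (Sig) = Sig` for all `α ∈ Sig`. -/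
def IsRootSystem {d : ℕ} (Sig : Finset (E d)) : Prop :=
  (0 : E d) ∉ Sig ∧
  Submodule.span ℝ (Sig : Set (E d)) = ⊤ ∧
  (∀ α ∈ Sig, ∀ t : ℝ, t • α ∈ Sig → t = 1 ∨ t = -1) ∧
  (∀ α ∈ Sig, ∀ β ∈ Sig, reflVec α β ∈ Sig)

/-- `Sp` is a positive system for `Sig`: `Sp = {α ∈ Sig : ⟪α, v⟫ > 0}` for a vector `v` not
orthogonal to any root. -/
def IsPositiveSystem {d : ℕ} (Sig Sp : Finset (E d)) : Prop :=
  ∃ v : E d, (∀ α ∈ Sig, ⟪α, v⟫ ≠ 0) ∧ ∀ α : E d, α ∈ Sp ↔ α ∈ Sig ∧ 0 < ⟪α, v⟫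

/-- The Weyl group of `Sig`: the subgroup of the orthogonal group of `ℝ^d` generated by the
reflections `s_α`, `α ∈ Sig`. -/
def weylGroup {d : ℕ} (Sig : Finset (E d)) : Subgroup (E d ≃ₗᵢ[ℝ] E d) :=
  Subgroup.closure {w : E d ≃ₗᵢ[ℝ] E d | ∃ α ∈ Sig, ∀ x : E d, w x = reflVec α x}

/-- Determinant of an orthogonal transformation (`±1`). -/
def dsign {d : ℕ} (w : E d ≃ₗᵢ[ℝ] E d) : ℝ := LinearMap.det (w.toLinearEquiv.toLinearMap)

/-- `π(X) = ∏_{α ∈ Sp} ⟪α, X⟫`. -/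
def piP {d : ℕ} (Sp : Finset (E d)) (X : E d) : ℝ := ∏ α ∈ Sp, ⟪α, X⟫

/-- The set `D = {(X,Y) : X ≠ wY for all w ∈ W}`. -/
def Dset {d : ℕ} (Sig : Finset (E d)) : Set (E d × E d) :=
  {p : E d × E d | ∀ w : weylGroup Sig, p.1 ≠ w.1 p.2}

/-- `R(X,Y) = ∑_{w ∈ W} det(w) |X - wY|^{-d}`. -/
def Rker {d : ℕ} (Sig : Finset (E d)) [Fintype ↥(weylGroup Sig)] (p : E d × E d) : ℝ :=
  ∑ w : ↥(weylGroup Sig), dsign w.1 * ‖p.1 - w.1 p.2‖ ^ (-(d : ℝ))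

/-- `X` is singular if `⟪α, X⟫ = 0` for some root `α`. -/
def IsSingular {d : ℕ} (Sig : Finset (E d)) (X : E d) : Prop := ∃ α ∈ Sig, ⟪α, X⟫ = 0

section AnalyticDivision

variable {V : Type*} [NormedAddCommGroup V] [NormedSpace ℝ V]

/-- The power series `q` with `p x - p (P x) = ℓ x • q x` whenever `x - P x = ℓ x • v`. -/
def FormalMultilinearSeries.divDiff (p : FormalMultilinearSeries ℝ V ℝ) (P : V →L[ℝ] V) (v : V) :
    FormalMultilinearSeries ℝ V ℝ := fun n =>
  ∑ i : Fin (n + 1), ((p (n + 1)).curryMid i v).compContinuousLinearMap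
    (fun j : Fin n => if j.castSucc < i then ContinuousLinearMap.id ℝ V else P)

theorem FormalMultilinearSeries.smul_divDiff_apply (p : FormalMultilinearSeries ℝ V ℝ)
    {P : V →L[ℝ] V} {v : V} {x : V} {t : ℝ} (hx : x - P x = t • v) (n : ℕ) :
    t * p.divDiff P v n (fun _ => x) = p (n + 1) (fun _ => x) - p (n + 1) (fun _ => P x) := by
  set A : ℕ → ℝ := fun k => p (n + 1) (fun j : Fin (n + 1) => if (j : ℕ) < k then x else P x)
    with hA
  have h0 : A 0 = p (n + 1) (fun _ => P x) := by simp [hA]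
  have h1 : A (n + 1) = p (n + 1) (fun _ => x) := by
    simp only [hA, Fin.is_lt, if_true]
  rw [← h0, ← h1, ← Finset.sum_range_sub, ← Fin.sum_univ_eq_sum_range (fun k => A (k + 1) - A k),
    FormalMultilinearSeries.divDiff, _root_.sum_apply, Finset.mul_sum]
  refine Finset.sum_congr rfl fun i _ => ?_
  set m : Fin n → V := fun j => if j.castSucc < i then x else P x with hm
  have hins : ∀ (k : ℕ) (y : V), (if (i : ℕ) < k then x else P x) = y →
      (∀ j : Fin n, ((i.succAbove j : Fin (n + 1)) : ℕ) < k ↔ j.castSucc < i) →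
      A k = (p (n + 1)).curryMid i y m := fun k y hy hk => by
    rw [ContinuousMultilinearMap.curryMid_apply]
    refine congrArg (p (n + 1)) (Fin.eq_insertNth_iff.2 ⟨hy, ?_⟩)
    ext1 j
    simp only [Fin.removeNth, hm, hk]
  have hA1 : A (i + 1) = (p (n + 1)).curryMid i x m := hins _ _ (by simp) fun j => by
    simp only [Fin.succAbove, Fin.lt_def, Fin.val_castSucc]
    split_ifs <;> simp only [Fin.val_castSucc, Fin.val_succ] <;> omega
  have hA0 : A i = (p (n + 1)).curryMid i (P x) m := hins _ _ (by simp) fun j => by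
    simp only [Fin.succAbove, Fin.lt_def, Fin.val_castSucc]
    split_ifs <;> simp only [Fin.val_castSucc, Fin.val_succ]
    omega
  rw [hA1, hA0, ← _root_.sub_apply, ← map_sub, hx, map_smul,
    _root_.smul_apply, smul_eq_mul,
    ContinuousMultilinearMap.compContinuousLinearMap_apply]
  congr 2
  ext1 j
  simp only [hm]
  split_ifs <;> simp

theorem FormalMultilinearSeries.norm_divDiff_le (p : FormalMultilinearSeries ℝ V ℝ)
    {P : V →L[ℝ] V} (v : V) {C : ℝ} (hC : 1 ≤ C) (hP : ‖P‖ ≤ C) (n : ℕ) :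
    ‖p.divDiff P v n‖ ≤ (n + 1) * (‖p (n + 1)‖ * ‖v‖ * C ^ n) := by
  have hterm : ∀ i ∈ (Finset.univ : Finset (Fin (n + 1))),
      ‖((p (n + 1)).curryMid i v).compContinuousLinearMap
        (fun j : Fin n => if j.castSucc < i then ContinuousLinearMap.id ℝ V else P)‖ ≤
        ‖p (n + 1)‖ * ‖v‖ * C ^ n := by
    intro i _
    refine (ContinuousMultilinearMap.norm_compContinuousLinearMap_le _ _).trans ?_
    have h1 : ‖(p (n + 1)).curryMid i v‖ ≤ ‖p (n + 1)‖ * ‖v‖ := by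
      refine ((ContinuousLinearMap.le_opNorm _ _)).trans ?_
      gcongr
      exact MultilinearMap.mkContinuousLinear_norm_le _ (norm_nonneg _) _
    have h2 : ∏ j : Fin n, ‖if j.castSucc < i then ContinuousLinearMap.id ℝ V else P‖ ≤ C ^ n := by
      calc _ ≤ ∏ _j : Fin n, C := by
            refine Finset.prod_le_prod (fun _ _ => norm_nonneg _) fun j _ => ?_
            split_ifs
            · exact ContinuousLinearMap.norm_id_le.trans hC
            · exact hP
        _ = C ^ n := by simp
    exact mul_le_mul h1 h2 (Finset.prod_nonneg fun _ _ => norm_nonneg _) (by positivity)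
  refine (norm_sum_le_of_le _ hterm).trans ?_
  simp

theorem FormalMultilinearSeries.radius_divDiff_pos (p : FormalMultilinearSeries ℝ V ℝ)
    (P : V →L[ℝ] V) (v : V) (hp : 0 < p.radius) : 0 < (p.divDiff P v).radius := by
  obtain ⟨r, hr0, hr⟩ := ENNReal.lt_iff_exists_nnreal_btwn.1 hp
  have hr0 : 0 < r := by exact_mod_cast hr0
  obtain ⟨K, hK, hpK⟩ := p.norm_mul_pow_le_of_lt_radius hr
  set C : NNReal := max 1 ‖P‖₊
  have hC1 : 1 ≤ C := le_max_left _ _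
  have hC0 : 0 < C := lt_of_lt_of_le one_pos hC1
  have hs : 0 < r / (2 * C) := by positivity
  refine lt_of_lt_of_le (ENNReal.coe_pos.2 hs)
    (FormalMultilinearSeries.le_radius_of_bound _ (‖v‖ * (K / r)) fun n => ?_)
  have hnorm := p.norm_divDiff_le v (P := P) (C := C) (by exact_mod_cast hC1)
    (by exact_mod_cast le_max_right 1 ‖P‖₊) n
  have hr0' : (0 : ℝ) < r := by exact_mod_cast hr0
  have hC0' : (0 : ℝ) < C := by exact_mod_cast hC0
  have hpn : ‖p (n + 1)‖ * (r : ℝ) ^ n ≤ K / r := by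
    rw [le_div_iff₀ hr0', mul_assoc, ← pow_succ]
    exact hpK (n + 1)
  have h2 : ((n : ℝ) + 1) / 2 ^ n ≤ 1 := by
    rw [div_le_one (by positivity)]
    exact_mod_cast Nat.succ_le_of_lt n.lt_two_pow_self
  push_cast
  calc ‖p.divDiff P v n‖ * ((r : ℝ) / (2 * C)) ^ n
      ≤ (n + 1) * (‖p (n + 1)‖ * ‖v‖ * C ^ n) * ((r : ℝ) / (2 * C)) ^ n := by gcongr
    _ = ((n + 1) / 2 ^ n) * (‖v‖ * (‖p (n + 1)‖ * r ^ n)) := by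
        rw [div_pow, mul_pow]; field_simp
    _ ≤ 1 * (‖v‖ * (K / r)) := by gcongr
    _ = _ := one_mul _

/-- Local division of an analytic function by a linear form along whose kernel it vanishes. -/
theorem AnalyticAt.exists_eventually_eq_mul {g : V → ℝ} {x₀ : V} (hg : AnalyticAt ℝ g x₀)
    (ℓ : V →L[ℝ] ℝ) {v : V} (hv : ℓ v = 1) (hx₀ : ℓ x₀ = 0)
    (hz : ∀ᶠ x in nhds x₀, ℓ x = 0 → g x = 0) :
    ∃ h : V → ℝ, AnalyticAt ℝ h x₀ ∧ ∀ᶠ x in nhds x₀, g x = ℓ x * h x := by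
  obtain ⟨p, r, hp⟩ := hg
  set P : V →L[ℝ] V := ContinuousLinearMap.id ℝ V - ℓ.smulRight v with hP
  have hPx : ∀ x, x - P x = ℓ x • v := fun x => by simp [hP]
  have hℓP : ∀ x, ℓ (P x) = 0 := fun x => by simp [hP, hv]
  have hq := p.radius_divDiff_pos P v hp.radius_pos
  have hqs := (p.divDiff P v).hasFPowerSeriesOnBall hq
  have hlim : Filter.Tendsto (fun x => x - x₀) (nhds x₀) (nhds 0) := by
    have : Continuous (fun x => x - x₀) := by fun_prop
    simpa using this.tendsto x₀
  refine ⟨fun x => (p.divDiff P v).sum (x - x₀), ?_, ?_⟩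
  · refine AnalyticAt.fun_comp (g := (p.divDiff P v).sum) ?_ (by fun_prop)
    rw [sub_self]
    exact hqs.analyticAt
  have hPlim : Filter.Tendsto (fun x => P (x - x₀)) (nhds x₀) (nhds 0) := by
    simpa only [map_zero] using! (P.continuous.tendsto 0).comp hlim
  have hPlim' : Filter.Tendsto (fun x => x₀ + P (x - x₀)) (nhds x₀) (nhds x₀) := by
    simpa using hPlim.const_add x₀
  filter_upwards [hlim.eventually (Metric.eball_mem_nhds (0 : V) hp.r_pos),
    hPlim.eventually (Metric.eball_mem_nhds (0 : V) hp.r_pos),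
    hlim.eventually (Metric.eball_mem_nhds (0 : V) hq), hPlim'.eventually hz] with x h1 h2 h3 h4
  have e1 := hp.hasSum h1
  have e2 := hp.hasSum h2
  rw [h4 (by simp [hx₀, hℓP])] at e2
  rw [add_sub_cancel] at e1
  have e3 := (hqs.hasSum h3).mul_left (ℓ x)
  rw [zero_add] at e3
  have e4 := (hasSum_nat_add_iff' 1).2 (e1.sub e2)
  have hx : (x - x₀) - P (x - x₀) = ℓ x • v := by rw [hPx, map_sub, hx₀, sub_zero]
  simp only [p.smul_divDiff_apply hx] at e3
  have e5 := e4.unique e3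
  have e6 : p 0 (fun _ => x - x₀) = p 0 (fun _ => P (x - x₀)) := by
    congr 1; ext1 i; exact i.elim0
  simpa [e6] using e5

/-- Division of an analytic function on an open set by a nonzero linear form along whose kernel
it vanishes. -/
theorem AnalyticOnNhd.exists_eq_mul {g : V → ℝ} {U : Set V} (hU : IsOpen U)
    (hg : AnalyticOnNhd ℝ g U) (ℓ : V →L[ℝ] ℝ) (hℓ : ℓ ≠ 0)
    (hz : ∀ x ∈ U, ℓ x = 0 → g x = 0) :
    ∃ h : V → ℝ, AnalyticOnNhd ℝ h U ∧ ∀ x ∈ U, g x = ℓ x * h x := by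
  obtain ⟨v, hv⟩ : ∃ v, ℓ v = 1 := by
    obtain ⟨w, hw⟩ : ∃ w, ℓ w ≠ 0 := by
      by_contra! h
      exact hℓ (ContinuousLinearMap.ext h)
    exact ⟨(ℓ w)⁻¹ • w, by simp [hw]⟩
  refine ⟨fun x => if ℓ x = 0 then fderiv ℝ g x v else g x / ℓ x, ?_, ?_⟩
  · intro x₀ hx₀
    by_cases h0 : ℓ x₀ = 0
    · obtain ⟨h, hh, he⟩ := (hg x₀ hx₀).exists_eventually_eq_mul ℓ hv h0
        (by filter_upwards [hU.mem_nhds hx₀] with x hx using hz x hx)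
      refine hh.congr ?_
      filter_upwards [he, he.eventually_nhds, hh.eventually_analyticAt] with x hx hxe hxa
      split_ifs with h1
      · have hd : HasFDerivAt (fun y => ℓ y * h y) (ℓ x • fderiv ℝ h x + h x • ℓ) x :=
          ℓ.hasFDerivAt.mul hxa.differentiableAt.hasFDerivAt
        have hxe' : g =ᶠ[nhds x] fun y => ℓ y * h y := hxe
        rw [hxe'.fderiv_eq, hd.fderiv]
        simp [h1, hv]
      · rw [hx]; field_simp
    · have : AnalyticAt ℝ (fun x => g x / ℓ x) x₀ :=
        (hg x₀ hx₀).div (ℓ.analyticAt x₀) h0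
      refine this.congr ?_
      filter_upwards [ℓ.continuous.continuousAt.eventually_ne h0] with x hx
      simp [hx]
  · intro x hx
    by_cases h : ℓ x = 0
    · simp [h, hz x hx h]
    · simp only [h, if_false]
      field_simp

/-- Division of an analytic function on an open set by a product of pairwise non-proportional
linear forms along whose kernels it vanishes. -/
theorem AnalyticOnNhd.exists_eq_prod_mul {ι : Type*} {U : Set V} (hU : IsOpen U)
    (ℓ : ι → V →L[ℝ] ℝ) (S : Finset ι) (hℓ : ∀ i ∈ S, ℓ i ≠ 0)
    (hne : ∀ i ∈ S, ∀ j ∈ S, i ≠ j → ∃ w, ℓ i w = 0 ∧ ℓ j w ≠ 0)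
    {g : V → ℝ} (hg : AnalyticOnNhd ℝ g U) (hz : ∀ i ∈ S, ∀ x ∈ U, ℓ i x = 0 → g x = 0) :
    ∃ h : V → ℝ, AnalyticOnNhd ℝ h U ∧ ∀ x ∈ U, g x = (∏ i ∈ S, ℓ i x) * h x := by
  induction S using Finset.induction_on generalizing g with
  | empty => exact ⟨g, hg, by simp⟩
  | insert j S hj ih =>
    obtain ⟨h, hh, he⟩ := hg.exists_eq_mul hU (ℓ j) (hℓ j (mem_insert_self _ _))
      (hz j (mem_insert_self _ _))
    obtain ⟨k, hk, hke⟩ := ih (fun i hi => hℓ i (mem_insert_of_mem hi))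
      (fun i hi l hl => hne i (mem_insert_of_mem hi) l (mem_insert_of_mem hl)) hh (by
        intro i hi x hx hix
        by_cases hjx : ℓ j x = 0
        · obtain ⟨w, hw0, hw⟩ := hne i (mem_insert_of_mem hi) j (mem_insert_self _ _)
            (fun e => hj (e ▸ hi))
          have hc : Continuous (fun t : ℝ => x + t • w) := by fun_prop
          have hlim : Filter.Tendsto (fun t : ℝ => x + t • w) (nhds 0) (nhds x) := by
            simpa using hc.tendsto 0
          have hev : ∀ᶠ t : ℝ in nhdsWithin 0 {0}ᶜ, h (x + t • w) = 0 := by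
            filter_upwards [nhdsWithin_le_nhds (hlim.eventually (hU.mem_nhds hx)),
              self_mem_nhdsWithin] with t ht ht0
            have h1 := he _ ht
            rw [hz i (mem_insert_of_mem hi) _ ht (by simp [hix, hw0])] at h1
            have h2 : ℓ j (x + t • w) ≠ 0 := by simpa [hjx, hw] using ht0
            exact (mul_eq_zero.1 h1.symm).resolve_left h2
          have hlim2 : Filter.Tendsto (fun t : ℝ => h (x + t • w)) (nhdsWithin 0 {0}ᶜ)
              (nhds (h x)) :=
            ((hh x hx).continuousAt.tendsto.comp hlim).mono_left nhdsWithin_le_nhds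
          exact tendsto_nhds_unique (hlim2.congr' hev) tendsto_const_nhds
        · have h1 := he x hx
          rw [hz i (mem_insert_of_mem hi) x hx hix] at h1
          exact (mul_eq_zero.1 h1.symm).resolve_left hjx)
    refine ⟨k, hk, fun x hx => ?_⟩
    rw [he x hx, hke x hx, prod_insert hj, mul_assoc]

end AnalyticDivision

section WeylKernel

variable {d : ℕ}

theorem dsign_mul (u w : E d ≃ₗᵢ[ℝ] E d) : dsign (u * w) = dsign u * dsign w :=
  LinearMap.det_comp _ _

theorem dsign_one : dsign (1 : E d ≃ₗᵢ[ℝ] E d) = 1 := LinearMap.det_id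

theorem dsign_mul_dsign_inv (w : E d ≃ₗᵢ[ℝ] E d) : dsign w * dsign w⁻¹ = 1 := by
  rw [← dsign_mul, mul_inv_cancel, dsign_one]

theorem reflection_eq_reflVec (α x : E d) : (ℝ ∙ α)ᗮ.reflection x = reflVec α x := by
  rw [Submodule.reflection_orthogonal_apply, Submodule.reflection_singleton_apply, reflVec,
    real_inner_self_eq_norm_sq, neg_sub, two_nsmul, ← add_smul]
  congr 2
  simp only [RCLike.ofReal_real_eq_id, id_eq]
  ring

theorem reflection_mem_weylGroup {Sig : Finset (E d)} {α : E d} (hα : α ∈ Sig) :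
    (ℝ ∙ α)ᗮ.reflection ∈ weylGroup Sig :=
  Subgroup.subset_closure ⟨α, hα, reflection_eq_reflVec α⟩

theorem dsign_reflection {α : E d} (hα : α ≠ 0) : dsign (ℝ ∙ α)ᗮ.reflection = -1 := by
  have h := (ℝ ∙ α)ᗮ.det_reflection
  rw [Submodule.orthogonal_orthogonal, finrank_span_singleton hα, pow_one] at h
  exact h

theorem reflection_eq_self_of_inner_eq_zero {α x : E d} (h : ⟪α, x⟫ = 0) :
    (ℝ ∙ α)ᗮ.reflection x = x := by
  rw [reflection_eq_reflVec, reflVec, h]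
  simp

/-- An element of the Weyl group has determinant `±1`. -/
theorem dsign_mul_self_of_mem {Sig : Finset (E d)} (h0 : (0 : E d) ∉ Sig)
    {w : E d ≃ₗᵢ[ℝ] E d} (hw : w ∈ weylGroup Sig) : dsign w * dsign w = 1 := by
  induction hw using Subgroup.closure_induction with
  | mem w hw =>
    obtain ⟨α, hα, hx⟩ := hw
    have hα0 : α ≠ 0 := fun e => h0 (e ▸ hα)
    have : w = (ℝ ∙ α)ᗮ.reflection := by
      ext1 x
      rw [hx, reflection_eq_reflVec]
    rw [this, dsign_reflection hα0]
    norm_num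
  | one => simp [dsign_one]
  | mul u w _ _ hu hw =>
    rw [dsign_mul, mul_mul_mul_comm, hu, hw, one_mul]
  | inv w _ hw =>
    have h := dsign_mul_dsign_inv w
    linear_combination (1 + dsign w * dsign w⁻¹) * h - dsign w⁻¹ * dsign w⁻¹ * hw

theorem dsign_inv_of_mem {Sig : Finset (E d)} (h0 : (0 : E d) ∉ Sig)
    {w : E d ≃ₗᵢ[ℝ] E d} (hw : w ∈ weylGroup Sig) : dsign w⁻¹ = dsign w := by
  linear_combination dsign w * dsign_mul_dsign_inv w - dsign w⁻¹ * dsign_mul_self_of_mem h0 hw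

theorem norm_sub_apply_eq (w : E d ≃ₗᵢ[ℝ] E d) (x y : E d) : ‖x - w y‖ = ‖w⁻¹ x - y‖ := by
  rw [← w.norm_map (w⁻¹ x - y), map_sub]
  congr 2
  exact (w.apply_symm_apply x).symm

theorem IsPositiveSystem.exists_inner_eq_zero {Sig Sp : Finset (E d)}
    (hroot : IsRootSystem Sig) (hpos : IsPositiveSystem Sig Sp)
    {α β : E d} (hα : α ∈ Sp) (hβ : β ∈ Sp) (hne : α ≠ β) :
    ∃ w : E d, ⟪α, w⟫ = 0 ∧ ⟪β, w⟫ ≠ 0 := by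
  obtain ⟨v, -, hv⟩ := hpos
  obtain ⟨hαS, hαv⟩ := (hv α).1 hα
  obtain ⟨hβS, hβv⟩ := (hv β).1 hβ
  have hα0 : ⟪α, α⟫ ≠ 0 := inner_self_ne_zero.2 fun e => hroot.1 (e ▸ hαS)
  set t : ℝ := ⟪α, β⟫ / ⟪α, α⟫ with ht
  have h1 : ⟪α, β - t • α⟫ = 0 := by
    rw [inner_sub_right, inner_smul_right, ht, div_mul_cancel₀ _ hα0, sub_self]
  refine ⟨β - t • α, h1, fun h2 => ?_⟩
  have h3 : ⟪β - t • α, β - t • α⟫ = 0 := by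
    rw [inner_sub_left, real_inner_smul_left, h1, h2]
    simp
  have h4 : β = t • α := sub_eq_zero.1 (inner_self_eq_zero.1 h3)
  rcases hroot.2.2.1 α hαS t (h4 ▸ hβS) with h | h
  · exact hne (by rw [h4, h, one_smul])
  · rw [h4, h, real_inner_smul_left] at hβv
    linarith

variable {Sig Sp : Finset (E d)} [Fintype ↥(weylGroup Sig)]

theorem Rker_swap (h0 : (0 : E d) ∉ Sig) (p : E d × E d) :
    Rker Sig p = Rker Sig (p.2, p.1) := by
  refine Fintype.sum_equiv (Equiv.inv _) _ _ fun w => ?_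
  rw [Equiv.inv_apply, InvMemClass.coe_inv, dsign_inv_of_mem h0 w.2, norm_sub_apply_eq,
    norm_sub_rev]

theorem Rker_apply_right (h0 : (0 : E d) ∉ Sig) (u : ↥(weylGroup Sig)) (p : E d × E d) :
    Rker Sig (p.1, u.1 p.2) = dsign u.1 * Rker Sig p := by
  rw [Rker, Rker, Finset.mul_sum]
  refine Fintype.sum_equiv (Equiv.mulRight u) _ _ fun w => ?_
  rw [Equiv.coe_mulRight, Subgroup.coe_mul, dsign_mul, LinearIsometryEquiv.coe_mul,
    Function.comp_apply]
  linear_combination (-(dsign w.1 * ‖p.1 - w.1 (u.1 p.2)‖ ^ (-(d : ℝ)))) *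
    dsign_mul_self_of_mem h0 u.2

theorem Rker_apply_left (h0 : (0 : E d) ∉ Sig) (u : ↥(weylGroup Sig)) (p : E d × E d) :
    Rker Sig (u.1 p.1, p.2) = dsign u.1 * Rker Sig p := by
  rw [Rker_swap h0, Rker_apply_right h0 u (p.2, p.1), Rker_swap h0 p]

theorem Rker_eq_zero_of_right (h0 : (0 : E d) ∉ Sig) {p : E d × E d}
    (hp : IsSingular Sig p.2) : Rker Sig p = 0 := by
  obtain ⟨α, hα, h⟩ := hp
  have h1 := Rker_apply_right h0 ⟨_, reflection_mem_weylGroup hα⟩ p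
  rw [reflection_eq_self_of_inner_eq_zero h, dsign_reflection fun e => h0 (e ▸ hα)] at h1
  linarith

theorem Rker_eq_zero_of_isSingular (h0 : (0 : E d) ∉ Sig) {p : E d × E d}
    (hp : IsSingular Sig p.1 ∨ IsSingular Sig p.2) : Rker Sig p = 0 := by
  rcases hp with hp | hp
  · rw [Rker_swap h0]
    exact Rker_eq_zero_of_right h0 hp
  · exact Rker_eq_zero_of_right h0 hp

theorem isOpen_Dset : IsOpen (Dset Sig) := by
  rw [Dset, Set.ofPred_forall]
  exact isOpen_iInter_of_finite fun w =>
    isOpen_ne_fun continuous_fst (w.1.continuous.comp continuous_snd)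

theorem analyticOnNhd_Rker : AnalyticOnNhd ℝ (Rker Sig) (Dset Sig) := by
  intro p hp
  refine Finset.analyticAt_fun_sum _ fun w _ => analyticAt_const.mul ?_
  have hne : p.1 - w.1 p.2 ≠ 0 := sub_ne_zero.2 (hp w)
  have hw : ContDiffAt ℝ ⊤ (fun q : E d × E d => q.1 - w.1 q.2) p :=
    contDiffAt_fst.sub (w.1.contDiff.contDiffAt.comp p contDiffAt_snd)
  exact ((hw.norm ℝ hne).rpow_const_of_ne (norm_ne_zero_iff.2 hne)).analyticAt

theorem exists_analyticOnNhd_Rker_eq (hroot : IsRootSystem Sig) (hpos : IsPositiveSystem Sig Sp) :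
    ∃ f : E d × E d → ℝ, AnalyticOnNhd ℝ f (Dset Sig) ∧
      ∀ p ∈ Dset Sig, Rker Sig p = piP Sp p.1 * piP Sp p.2 * f p := by
  have hsub : ∀ α ∈ Sp, α ∈ Sig := fun α hα => by
    obtain ⟨v, -, hv⟩ := hpos
    exact ((hv α).1 hα).1
  have hself : ∀ α ∈ Sp, ⟪α, α⟫ ≠ 0 := fun α hα =>
    inner_self_ne_zero.2 fun e => hroot.1 (e ▸ hsub α hα)
  set ℓ : E d ⊕ E d → (E d × E d →L[ℝ] ℝ) :=
    Sum.elim (fun α => (innerSL ℝ α).comp (ContinuousLinearMap.fst ℝ _ _))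
      (fun α => (innerSL ℝ α).comp (ContinuousLinearMap.snd ℝ _ _))
  have hl : ∀ α p, ℓ (Sum.inl α) p = ⟪α, p.1⟫ := fun α p => rfl
  have hr : ∀ α p, ℓ (Sum.inr α) p = ⟪α, p.2⟫ := fun α p => rfl
  have hne0 : ∀ i ∈ Sp.disjSum Sp, ℓ i ≠ 0 := by
    rintro (α | α) hα h
    · rw [inl_mem_disjSum] at hα
      exact hself α hα (by rw [← hl α (α, 0), h]; rfl)
    · rw [inr_mem_disjSum] at hα
      exact hself α hα (by rw [← hr α (0, α), h]; rfl)
  have hpair : ∀ i ∈ Sp.disjSum Sp, ∀ j ∈ Sp.disjSum Sp, i ≠ j →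
      ∃ w, ℓ i w = 0 ∧ ℓ j w ≠ 0 := by
    rintro (α | α) hα (β | β) hβ hne
    · rw [inl_mem_disjSum] at hα hβ
      obtain ⟨w, h1, h2⟩ := hpos.exists_inner_eq_zero hroot hα hβ (by simpa using hne)
      exact ⟨(w, 0), h1, h2⟩
    · rw [inr_mem_disjSum] at hβ
      exact ⟨(0, β), by simp [hl], hself β hβ⟩
    · rw [inl_mem_disjSum] at hβ
      exact ⟨(β, 0), by simp [hr], hself β hβ⟩
    · rw [inr_mem_disjSum] at hα hβ
      obtain ⟨w, h1, h2⟩ := hpos.exists_inner_eq_zero hroot hα hβ (by simpa using hne)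
      exact ⟨(0, w), h1, h2⟩
  have hzero : ∀ i ∈ Sp.disjSum Sp, ∀ p ∈ Dset Sig, ℓ i p = 0 → Rker Sig p = 0 := by
    rintro (α | α) hα p _ h
    · rw [inl_mem_disjSum] at hα
      exact Rker_eq_zero_of_isSingular hroot.1 (Or.inl ⟨α, hsub α hα, h⟩)
    · rw [inr_mem_disjSum] at hα
      exact Rker_eq_zero_of_isSingular hroot.1 (Or.inr ⟨α, hsub α hα, h⟩)
  obtain ⟨f, hf, he⟩ := analyticOnNhd_Rker.exists_eq_prod_mul isOpen_Dset ℓ (Sp.disjSum Sp)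
    hne0 hpair hzero
  refine ⟨f, hf, fun p hp => ?_⟩
  rw [he p hp, prod_disjSum]
  rfl

end WeylKernel

/-- On `D`, the kernel `R(X,Y) = ∑_{w∈W} det(w) |X - wY|^{-d}` satisfies:
(1) symmetry `R(X,Y) = R(Y,X)`; (2) skew-symmetry `R(w₀X,Y) = det(w₀) R(X,Y)` and
`R(X,w₀Y) = det(w₀) R(X,Y)` for `w₀ ∈ W`; (3) `R(X,Y) = 0` when `X` or `Y` is singular;
(4) `R(X,Y) = π(X) π(Y) f(X,Y)` for a function `f` real-analytic on `D`. -/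
theorem stmt_5 (d : ℕ) (hd : 1 ≤ d) (Sig Sp : Finset (E d))
    (hroot : IsRootSystem Sig) (hpos : IsPositiveSystem Sig Sp)
    [Fintype ↥(weylGroup Sig)] :
    (∀ p ∈ Dset Sig, Rker Sig p = Rker Sig (p.2, p.1)) ∧
    (∀ w₀ : ↥(weylGroup Sig), ∀ p ∈ Dset Sig,
      Rker Sig (w₀.1 p.1, p.2) = dsign w₀.1 * Rker Sig p ∧
      Rker Sig (p.1, w₀.1 p.2) = dsign w₀.1 * Rker Sig p) ∧
    (∀ p ∈ Dset Sig, IsSingular Sig p.1 ∨ IsSingular Sig p.2 → Rker Sig p = 0) ∧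
    (∃ f : E d × E d → ℝ, (∀ p ∈ Dset Sig, AnalyticAt ℝ f p) ∧
      ∀ p ∈ Dset Sig, Rker Sig p = piP Sp p.1 * piP Sp p.2 * f p) := by
  have h0 := hroot.1
  exact ⟨fun p _ => Rker_swap h0 p,
    fun w₀ p _ => ⟨Rker_apply_left h0 w₀ p, Rker_apply_right h0 w₀ p⟩,
    fun p _ hp => Rker_eq_zero_of_isSingular h0 hp,
    exists_analyticOnNhd_Rker_eq hroot hpos⟩
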